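/- arXiv:1404.0354 — 9 statements merged into one kernel-verified Lean document; each statement's English description precedes it below -/
import Mathlib

section
/- Suppose hRD ≠ 0. Then the sum-rate-optimal quantization noise variance σ*² := (1 + A/S) / ((1 + hRD²·PR/D)^((1−β)/β) − 1) is a positive real number, and at this point the two sum-rate terms coincide: I1(σ*²) = I2(σ*²). -/
/-- The root of `q * (S * x) = S * (1 + x) + A` balances the two arguments of the logarithms. -/
lemma add_div_one_add_eq_mul {S A q x : ℝ} (hS : S ≠ 0) (hq : q - 1 ≠ 0) (hx1 : 1 + x ≠ 0)
    (hx : x = (1 + A / S) / (q - 1)) : S + A / (1 + x) = q * (S * x / (1 + x)) := by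
  have key : x * (q - 1) * S = S + A := by
    rw [hx, div_mul_cancel₀ _ hq]
    field_simp
  field_simp
  linear_combination -key


theorem stmt_2
  (h1D h2D h1R h2R hRD P11 P21 P12 P22 PR beta S D A : ℝ)
  (hP11 : 0 < P11) (hP21 : 0 < P21) (hP12 : 0 < P12) (hP22 : 0 < P22) (hPR : 0 < PR)
  (hbeta0 : 0 < beta) (hbeta1 : beta < 1)
  (hSdef : S = 1 + h1D ^ 2 * P11 + h2D ^ 2 * P21)
  (hDdef : D = 1 + h1D ^ 2 * P12 + h2D ^ 2 * P22)
  (hAdef : A = (h1D * h2R - h1R * h2D) ^ 2 * P11 * P21 + h1R ^ 2 * P11 + h2R ^ 2 * P21)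
  (hRD0 : hRD ≠ 0)
  (I1 : ℝ → ℝ)
  (hI1 : ∀ x : ℝ, I1 x =
    beta / 2 * Real.logb 2 (S + A / (1 + x)) + (1 - beta) / 2 * Real.logb 2 D)
  (I2 : ℝ → ℝ)
  (hI2 : ∀ x : ℝ, I2 x =
    beta / 2 * Real.logb 2 (S * x / (1 + x)) + (1 - beta) / 2 * Real.logb 2 (D + hRD ^ 2 * PR))
  (sig : ℝ)
  (hsig : sig = (1 + A / S) / ((1 + hRD ^ 2 * PR / D) ^ ((1 - beta) / beta) - 1))
  : 0 < sig ∧ I1 sig = I2 sig := by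
  have hS : 0 < S := by rw [hSdef]; positivity
  have hD : 0 < D := by rw [hDdef]; positivity
  have hA : 0 ≤ A := by rw [hAdef]; positivity
  have hc : 0 < hRD ^ 2 * PR := by positivity
  have hexp : 0 < (1 - beta) / beta := div_pos (sub_pos.2 hbeta1) hbeta0
  have hbase : 1 < 1 + hRD ^ 2 * PR / D := lt_add_of_pos_right 1 (div_pos hc hD)
  have hbase0 : 0 < 1 + hRD ^ 2 * PR / D := one_pos.trans hbase
  have hq : 0 < (1 + hRD ^ 2 * PR / D) ^ ((1 - beta) / beta) - 1 :=
    sub_pos.2 (Real.one_lt_rpow hbase hexp)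
  have hsig0 : 0 < sig := by rw [hsig]; positivity
  refine ⟨hsig0, ?_⟩
  have hbalance := add_div_one_add_eq_mul hS.ne' hq.ne' (by positivity) hsig
  have hlog : Real.logb 2 (1 + hRD ^ 2 * PR / D) =
      Real.logb 2 (D + hRD ^ 2 * PR) - Real.logb 2 D := by
    rw [← Real.logb_div (by positivity) hD.ne', add_div, div_self hD.ne']
  rw [hI1, hI2, hbalance, Real.logb_mul (Real.rpow_pos_of_pos hbase0 _).ne' (by positivity),
    Real.logb_rpow_eq_mul_logb_of_pos hbase0, hlog]
  field_simp
  ring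
end

section
/- Suppose A > 0 and hRD ≠ 0, and let σ*² := (1 + A/S) / ((1 + hRD²·PR/D)^((1−β)/β) − 1). Then σ*² is the unique positive real x satisfying I1(x) = I2(x): for every x > 0 with I1(x) = I2(x) one has x = σ*². -/
/-- Where the two rate terms agree, the ratio of the arguments of their first logarithms is a power
of the ratio of the arguments of their second logarithms. -/
theorem div_eq_rpow_of_logb_combination_eq {b a c p q beta : ℝ} (hb : 1 < b) (ha : 0 < a)
    (hc : 0 < c) (hp : 0 < p) (hq : 0 < q) (hbeta : beta ≠ 0)
    (h : beta / 2 * Real.logb b a + (1 - beta) / 2 * Real.logb b p =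
      beta / 2 * Real.logb b c + (1 - beta) / 2 * Real.logb b q) :
    a / c = (q / p) ^ ((1 - beta) / beta) := by
  apply Real.logb_injOn_pos hb (div_pos ha hc) (Real.rpow_pos_of_pos (div_pos hq hp) _)
  rw [Real.logb_rpow_eq_mul_logb_of_pos (div_pos hq hp), Real.logb_div ha.ne' hc.ne',
    Real.logb_div hq.ne' hp.ne']
  field_simp
  linarith

/-- The crossing point of the two rate terms, as a function of the quantization-noise variance. -/
theorem eq_of_rate_eq {S A D E beta x : ℝ} (hS : 0 < S) (hA : 0 < A) (hD : 0 < D) (hE : 0 < E)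
    (hbeta0 : 0 < beta) (hbeta1 : beta < 1) (hx : 0 < x)
    (h : beta / 2 * Real.logb 2 (S + A / (1 + x)) + (1 - beta) / 2 * Real.logb 2 D =
      beta / 2 * Real.logb 2 (S * x / (1 + x)) + (1 - beta) / 2 * Real.logb 2 (D + E)) :
    x = (1 + A / S) / ((1 + E / D) ^ ((1 - beta) / beta) - 1) := by
  have hratio := div_eq_rpow_of_logb_combination_eq one_lt_two (by positivity) (by positivity) hD
    (by positivity) hbeta0.ne' h
  have hgain : 1 < (1 + E / D) ^ ((1 - beta) / beta) :=
    Real.one_lt_rpow (lt_add_of_pos_right 1 (div_pos hE hD)) (div_pos (sub_pos.2 hbeta1) hbeta0)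
  rw [add_div D E D, div_self hD.ne'] at hratio
  rw [eq_div_iff (sub_pos.2 hgain).ne', ← hratio]
  field_simp
  ring

theorem stmt_3
  (h1D h2D h1R h2R hRD P11 P21 P12 P22 PR beta S D A : ℝ)
  (hP11 : 0 < P11) (hP21 : 0 < P21) (hP12 : 0 < P12) (hP22 : 0 < P22) (hPR : 0 < PR)
  (hbeta0 : 0 < beta) (hbeta1 : beta < 1)
  (hSdef : S = 1 + h1D ^ 2 * P11 + h2D ^ 2 * P21)
  (hDdef : D = 1 + h1D ^ 2 * P12 + h2D ^ 2 * P22)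
  (hAdef : A = (h1D * h2R - h1R * h2D) ^ 2 * P11 * P21 + h1R ^ 2 * P11 + h2R ^ 2 * P21)
  (hApos : 0 < A) (hRD0 : hRD ≠ 0)
  (I1 : ℝ → ℝ)
  (hI1 : ∀ x : ℝ, I1 x =
    beta / 2 * Real.logb 2 (S + A / (1 + x)) + (1 - beta) / 2 * Real.logb 2 D)
  (I2 : ℝ → ℝ)
  (hI2 : ∀ x : ℝ, I2 x =
    beta / 2 * Real.logb 2 (S * x / (1 + x)) + (1 - beta) / 2 * Real.logb 2 (D + hRD ^ 2 * PR))
  (sig : ℝ)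
  (hsig : sig = (1 + A / S) / ((1 + hRD ^ 2 * PR / D) ^ ((1 - beta) / beta) - 1))
  : ∀ x : ℝ, 0 < x → I1 x = I2 x → x = sig := by
  intro x hx hI
  have hS : 0 < S := by rw [hSdef]; positivity
  have hD : 0 < D := by rw [hDdef]; positivity
  rw [hI1, hI2] at hI
  rw [hsig]
  exact eq_of_rate_eq hS hApos hD (by positivity) hbeta0 hbeta1 hx hI
end

section
/- Suppose A > 0 and hRD ≠ 0, and let σ*² := (1 + A/S) / ((1 + hRD²·PR/D)^((1−β)/β) − 1). Then σ*² maximizes the GQF achievable sum rate over all quantization-noise variances: for every x > 0, min(I1(x), I2(x)) ≤ min(I1(σ*²), I2(σ*²)), and the maximal value equals I1(σ*²). -/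
/-- If `f` is antitone and `g` is monotone on `s`, their pointwise minimum is maximal on `s` at any
crossing point. -/
theorem min_le_min_of_antitoneOn_of_monotoneOn_of_eq {α β : Type*} [LinearOrder α] [LinearOrder β]
    {f g : α → β} {s : Set α} (hf : AntitoneOn f s) (hg : MonotoneOn g s) {a : α} (ha : a ∈ s)
    (h : f a = g a) {x : α} (hx : x ∈ s) : min (f x) (g x) ≤ min (f a) (g a) := by
  rcases le_total x a with hxa | hax
  · exact (min_le_right _ _).trans (le_min ((hg hx ha hxa).trans h.ge) (hg hx ha hxa))
  · exact (min_le_left _ _).trans (le_min (hf ha hx hax) ((hf ha hx hax).trans h.le))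

theorem stmt_4
  (h1D h2D h1R h2R hRD P11 P21 P12 P22 PR beta S D A : ℝ)
  (hP11 : 0 < P11) (hP21 : 0 < P21) (hP12 : 0 < P12) (hP22 : 0 < P22) (hPR : 0 < PR)
  (hbeta0 : 0 < beta) (hbeta1 : beta < 1)
  (hSdef : S = 1 + h1D ^ 2 * P11 + h2D ^ 2 * P21)
  (hDdef : D = 1 + h1D ^ 2 * P12 + h2D ^ 2 * P22)
  (hAdef : A = (h1D * h2R - h1R * h2D) ^ 2 * P11 * P21 + h1R ^ 2 * P11 + h2R ^ 2 * P21)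
  (hApos : 0 < A) (hRD0 : hRD ≠ 0)
  (I1 : ℝ → ℝ)
  (hI1 : ∀ x : ℝ, I1 x =
    beta / 2 * Real.logb 2 (S + A / (1 + x)) + (1 - beta) / 2 * Real.logb 2 D)
  (I2 : ℝ → ℝ)
  (hI2 : ∀ x : ℝ, I2 x =
    beta / 2 * Real.logb 2 (S * x / (1 + x)) + (1 - beta) / 2 * Real.logb 2 (D + hRD ^ 2 * PR))
  (sig : ℝ)
  (hsig : sig = (1 + A / S) / ((1 + hRD ^ 2 * PR / D) ^ ((1 - beta) / beta) - 1))
  : (∀ x : ℝ, 0 < x → min (I1 x) (I2 x) ≤ min (I1 sig) (I2 sig)) ∧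
    min (I1 sig) (I2 sig) = I1 sig := by
  have hS : 0 < S := by rw [hSdef]; positivity
  have hD : 0 < D := by rw [hDdef]; positivity
  set K := (1 + hRD ^ 2 * PR / D) ^ ((1 - beta) / beta) with hK
  have hgain : 0 < hRD ^ 2 * PR / D := by positivity
  have hK1 : 1 < K :=
    Real.one_lt_rpow (by linarith) (div_pos (by linarith) hbeta0)
  have hKsub : 0 < K - 1 := by linarith
  have hsig0 : 0 < sig := by rw [hsig]; positivity
  have hcross : S + A / (1 + sig) = S * sig / (1 + sig) * K := by
    have hmul : S * sig * (K - 1) = S + A := by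
      rw [hsig]
      field_simp
    field_simp
    linarith
  have hlogK : beta * Real.logb 2 K = (1 - beta) * Real.logb 2 (1 + hRD ^ 2 * PR / D) := by
    rw [hK, Real.logb_rpow_eq_mul_logb_of_pos (by positivity)]
    field_simp
  have hlogD : Real.logb 2 (D + hRD ^ 2 * PR) =
      Real.logb 2 D + Real.logb 2 (1 + hRD ^ 2 * PR / D) := by
    rw [← Real.logb_mul hD.ne' (by positivity)]
    congr 1
    field_simp
  have heq : I1 sig = I2 sig := by
    rw [hI1, hI2, hcross, Real.logb_mul (by positivity) (by positivity), hlogD]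
    linarith
  have hanti : AntitoneOn I1 (Set.Ioi 0) := by
    intro x hx y hy hxy
    rw [Set.mem_Ioi] at hx hy
    rw [hI1, hI1]
    gcongr
    norm_num
  have hmono : MonotoneOn I2 (Set.Ioi 0) := by
    intro x hx y hy hxy
    rw [Set.mem_Ioi] at hx hy
    have hfrac : S * x / (1 + x) ≤ S * y / (1 + y) := by
      rw [div_le_div_iff₀ (by linarith) (by linarith)]
      nlinarith [mul_le_mul_of_nonneg_left hxy hS.le]
    rw [hI2, hI2]
    gcongr
    norm_num
  exact ⟨fun x hx => min_le_min_of_antitoneOn_of_monotoneOn_of_eq hanti hmono hsig0 heq hx,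
    min_eq_left heq.le⟩
end

section
/- Suppose hRD ≠ 0, let σ*² := (1 + A/S) / ((1 + hRD²·PR/D)^((1−β)/β) − 1), and let x ≥ σ*² be a quantization-noise variance satisfying the compress-and-forward feasibility condition. Then I1(x) ≤ I2(x); in particular the GQF achievable sum rate min(I1(x), I2(x)) equals the compress-and-forward sum rate I1(x). -/
theorem stmt_5
  (h1D h2D h1R h2R hRD P11 P21 P12 P22 PR beta S D A : ℝ)
  (hP11 : 0 < P11) (hP21 : 0 < P21) (hP12 : 0 < P12) (hP22 : 0 < P22) (hPR : 0 < PR)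
  (hbeta0 : 0 < beta) (hbeta1 : beta < 1)
  (hSdef : S = 1 + h1D ^ 2 * P11 + h2D ^ 2 * P21)
  (hDdef : D = 1 + h1D ^ 2 * P12 + h2D ^ 2 * P22)
  (hAdef : A = (h1D * h2R - h1R * h2D) ^ 2 * P11 * P21 + h1R ^ 2 * P11 + h2R ^ 2 * P21)
  (hRD0 : hRD ≠ 0)
  (I1 : ℝ → ℝ)
  (hI1 : ∀ x : ℝ, I1 x =
    beta / 2 * Real.logb 2 (S + A / (1 + x)) + (1 - beta) / 2 * Real.logb 2 D)
  (I2 : ℝ → ℝ)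
  (hI2 : ∀ x : ℝ, I2 x =
    beta / 2 * Real.logb 2 (S * x / (1 + x)) + (1 - beta) / 2 * Real.logb 2 (D + hRD ^ 2 * PR))
  (sig : ℝ)
  (hsig : sig = (1 + A / S) / ((1 + hRD ^ 2 * PR / D) ^ ((1 - beta) / beta) - 1))
  (x : ℝ) (hx : sig ≤ x)
  : I1 x ≤ I2 x ∧ min (I1 x) (I2 x) = I1 x := by
  have hS : 0 < S := by rw [hSdef]; positivity
  have hD : 0 < D := by rw [hDdef]; positivity
  have hA : 0 ≤ A := by rw [hAdef]; positivity
  have hH : 0 < hRD ^ 2 * PR := by positivity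
  have hexp : 0 < (1 - beta) / beta := div_pos (by linarith) hbeta0
  have hT : 1 < 1 + hRD ^ 2 * PR / D := by
    have := div_pos hH hD
    linarith
  have hlogR : Real.logb 2 ((1 + hRD ^ 2 * PR / D) ^ ((1 - beta) / beta)) =
      (1 - beta) / beta * (Real.logb 2 (D + hRD ^ 2 * PR) - Real.logb 2 D) := by
    rw [Real.logb_rpow_eq_mul_logb_of_pos (by linarith),
      ← Real.logb_div (by positivity) hD.ne', add_div, div_self hD.ne']
  have hR : 1 < (1 + hRD ^ 2 * PR / D) ^ ((1 - beta) / beta) := Real.one_lt_rpow hT hexp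
  generalize (1 + hRD ^ 2 * PR / D) ^ ((1 - beta) / beta) = R at hsig hlogR hR
  have hR1 : 0 < R - 1 := by linarith
  have hx0 : 0 < x := lt_of_lt_of_le (by rw [hsig]; positivity) hx
  have hfeas : S + A ≤ S * (x * (R - 1)) := by
    rw [hsig, div_le_iff₀ hR1] at hx
    have h := mul_le_mul_of_nonneg_left hx hS.le
    rwa [mul_add, mul_one, mul_div_cancel₀ _ hS.ne'] at h
  have hle : S + A / (1 + x) ≤ S * x / (1 + x) * R := by
    have h1 : S + A / (1 + x) = (S * (1 + x) + A) / (1 + x) := by field_simp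
    rw [h1, div_mul_eq_mul_div]
    gcongr
    linarith
  have hlog := Real.logb_le_logb_of_le one_lt_two (by positivity) hle
  rw [Real.logb_mul (by positivity) (by positivity), hlogR] at hlog
  have hmain : I1 x ≤ I2 x := by
    rw [hI1, hI2]
    have h := mul_le_mul_of_nonneg_left hlog (half_pos hbeta0).le
    have hcoef : beta / 2 * ((1 - beta) / beta *
        (Real.logb 2 (D + hRD ^ 2 * PR) - Real.logb 2 D)) =
        (1 - beta) / 2 * (Real.logb 2 (D + hRD ^ 2 * PR) - Real.logb 2 D) := by
      field_simp
    rw [mul_add, hcoef] at h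
    linarith
  exact ⟨hmain, min_eq_left hmain⟩
end

section
/- Suppose hRD ≠ 0, let σ*² := (1 + A/S) / ((1 + hRD²·PR/D)^((1−β)/β) − 1), and suppose the quantization-noise variance x satisfies 0 < x < σ*² (a compression finer than the relay–destination link can support). Then I2(x) < I1(x); in particular the GQF achievable sum rate min(I1(x), I2(x)) equals I2(x). -/
theorem stmt_6
  (h1D h2D h1R h2R hRD P11 P21 P12 P22 PR beta S D A : ℝ)
  (hP11 : 0 < P11) (hP21 : 0 < P21) (hP12 : 0 < P12) (hP22 : 0 < P22) (hPR : 0 < PR)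
  (hbeta0 : 0 < beta) (hbeta1 : beta < 1)
  (hSdef : S = 1 + h1D ^ 2 * P11 + h2D ^ 2 * P21)
  (hDdef : D = 1 + h1D ^ 2 * P12 + h2D ^ 2 * P22)
  (hAdef : A = (h1D * h2R - h1R * h2D) ^ 2 * P11 * P21 + h1R ^ 2 * P11 + h2R ^ 2 * P21)
  (hRD0 : hRD ≠ 0)
  (I1 : ℝ → ℝ)
  (hI1 : ∀ x : ℝ, I1 x =
    beta / 2 * Real.logb 2 (S + A / (1 + x)) + (1 - beta) / 2 * Real.logb 2 D)
  (I2 : ℝ → ℝ)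
  (hI2 : ∀ x : ℝ, I2 x =
    beta / 2 * Real.logb 2 (S * x / (1 + x)) + (1 - beta) / 2 * Real.logb 2 (D + hRD ^ 2 * PR))
  (sig : ℝ)
  (hsig : sig = (1 + A / S) / ((1 + hRD ^ 2 * PR / D) ^ ((1 - beta) / beta) - 1))
  (x : ℝ) (hx0 : 0 < x) (hxsig : x < sig)
  : I2 x < I1 x ∧ min (I1 x) (I2 x) = I2 x := by
  have hS : 0 < S := by rw [hSdef]; positivity
  have hD : 0 < D := by rw [hDdef]; positivity
  have hA : 0 ≤ A := by rw [hAdef]; positivity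
  have hT : 1 < 1 + hRD ^ 2 * PR / D := by
    have : 0 < hRD ^ 2 * PR / D := by positivity
    linarith
  have hDT : D + hRD ^ 2 * PR = D * (1 + hRD ^ 2 * PR / D) := by field_simp
  have hlogDT : Real.logb 2 (D + hRD ^ 2 * PR) =
      Real.logb 2 D + Real.logb 2 (1 + hRD ^ 2 * PR / D) := by
    rw [hDT, Real.logb_mul hD.ne' (by positivity)]
  have hK : 1 < (1 + hRD ^ 2 * PR / D) ^ ((1 - beta) / beta) :=
    Real.one_lt_rpow hT (div_pos (by linarith) hbeta0)
  have hlogK := Real.logb_rpow_eq_mul_logb_of_pos (b := 2) (y := (1 - beta) / beta)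
    (zero_lt_one.trans hT)
  generalize 1 + hRD ^ 2 * PR / D = T at *
  generalize T ^ ((1 - beta) / beta) = K at *
  have hxK : x * (K - 1) < 1 + A / S := by
    rwa [hsig, lt_div_iff₀ (by linarith)] at hxsig
  have hprod : S * x / (1 + x) * K < S + A / (1 + x) := by
    have hclear : S * (x * (K - 1)) < S + A := by
      calc S * (x * (K - 1)) < S * (1 + A / S) := by gcongr
        _ = S + A := by field_simp
    have hleft : S * x / (1 + x) * K = S * x * K / (1 + x) := by ring
    have hright : S + A / (1 + x) = (S * (1 + x) + A) / (1 + x) := by field_simp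
    rw [hleft, hright]
    gcongr
    linarith
  have hlog := Real.logb_lt_logb (b := 2) one_lt_two (by positivity) hprod
  rw [Real.logb_mul (by positivity) (by positivity), hlogK] at hlog
  have hlt : I2 x < I1 x := by
    rw [hI1, hI2, hlogDT]
    have hscaled := mul_lt_mul_of_pos_left hlog (half_pos hbeta0)
    have hcancel : beta / 2 * ((1 - beta) / beta * Real.logb 2 T) =
        (1 - beta) / 2 * Real.logb 2 T := by field_simp
    rw [mul_add, hcancel] at hscaled
    linarith
  exact ⟨hlt, min_eq_right hlt.le⟩
end

section
/- Suppose hRD ≠ 0. Then the individual-rate-optimal quantization noise variance σᵢ*² := (1 + hR²·P1/(1 + hD²·P1)) / ((1 + hRD²·PR/(1 + hD²·P2))^((1−β)/β) − 1) is a positive real number, and at this point the two individual-rate terms coincide: K1(σᵢ*²) = K2(σᵢ*²). -/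
theorem stmt_12
  (hD hR hRD P1 P2 PR beta : ℝ)
  (hP1 : 0 < P1) (hP2 : 0 < P2) (hPR : 0 < PR)
  (hbeta0 : 0 < beta) (hbeta1 : beta < 1)
  (K1 K2 : ℝ → ℝ)
  (hK1 : ∀ x : ℝ, K1 x =
    beta / 2 * Real.logb 2 (1 + hD ^ 2 * P1 + hR ^ 2 * P1 / (1 + x)) +
      (1 - beta) / 2 * Real.logb 2 (1 + hD ^ 2 * P2))
  (hK2 : ∀ x : ℝ, K2 x =
    beta / 2 * Real.logb 2 ((1 + hD ^ 2 * P1) * x / (1 + x)) +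
      (1 - beta) / 2 * Real.logb 2 (1 + hD ^ 2 * P2 + hRD ^ 2 * PR))
  (hRD0 : hRD ≠ 0)
  (sig : ℝ)
  (hsig : sig = (1 + hR ^ 2 * P1 / (1 + hD ^ 2 * P1)) /
      ((1 + hRD ^ 2 * PR / (1 + hD ^ 2 * P2)) ^ ((1 - beta) / beta) - 1))
  : 0 < sig ∧ K1 sig = K2 sig := by
  have ha : 0 < 1 + hD ^ 2 * P1 := by positivity
  have hb : 0 ≤ hR ^ 2 * P1 := by positivity
  have hd : 0 < 1 + hD ^ 2 * P2 := by positivity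
  have hc : 0 < hRD ^ 2 * PR := by positivity
  rw [hK1, hK2]
  generalize 1 + hD ^ 2 * P1 = a at *
  generalize hR ^ 2 * P1 = b at *
  generalize 1 + hD ^ 2 * P2 = d at *
  generalize hRD ^ 2 * PR = c at *
  have hT : 1 < (1 + c / d) ^ ((1 - beta) / beta) :=
    Real.one_lt_rpow (by linarith [div_pos hc hd]) (div_pos (by linarith) hbeta0)
  have hlogT : Real.logb 2 ((1 + c / d) ^ ((1 - beta) / beta)) =
      (1 - beta) / beta * (Real.logb 2 (d + c) - Real.logb 2 d) := by
    rw [Real.logb_rpow_eq_mul_logb_of_pos (by positivity),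
      ← Real.logb_div (by positivity) hd.ne', add_div, div_self hd.ne']
  generalize (1 + c / d) ^ ((1 - beta) / beta) = T at *
  have hT1 : 0 < T - 1 := sub_pos.mpr hT
  have hpos : 0 < sig := by rw [hsig]; positivity
  refine ⟨hpos, ?_⟩
  have hfactor : a + b / (1 + sig) = a * sig / (1 + sig) * T := by
    have hmul : a * sig * (T - 1) = a + b := by
      rw [hsig]
      field_simp
    field_simp
    linarith
  rw [hfactor, Real.logb_mul (by positivity) (by positivity), hlogT]
  field_simp
  ring
end

section
/- Suppose hR ≠ 0 and hRD ≠ 0, and let σᵢ*² := (1 + hR²·P1/(1 + hD²·P1)) / ((1 + hRD²·PR/(1 + hD²·P2))^((1−β)/β) − 1). Then σᵢ*² is the unique positive real x satisfying K1(x) = K2(x): for every x > 0 with K1(x) = K2(x) one has x = σᵢ*². -/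
/-- Equality of two time-shared rates, solved for the logarithm in the first slot. -/
theorem mul_logb_eq_logb_rpow_mul {b u v B C : ℝ} (hb : b ≠ 0) (hv : v ≠ 0)
    (hB : 0 < B) (hC : 0 < C)
    (h : b / 2 * Real.logb 2 u + (1 - b) / 2 * Real.logb 2 B =
      b / 2 * Real.logb 2 v + (1 - b) / 2 * Real.logb 2 C) :
    Real.logb 2 u = Real.logb 2 (v * (C / B) ^ ((1 - b) / b)) := by
  have hCB : 0 < C / B := div_pos hC hB
  rw [Real.logb_mul hv (Real.rpow_pos_of_pos hCB _).ne', Real.logb_rpow_eq_mul_logb_of_pos hCB,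
    Real.logb_div hC.ne' hB.ne']
  field_simp
  linarith

theorem stmt_13
  (hD hR hRD P1 P2 PR beta : ℝ)
  (hP1 : 0 < P1) (hP2 : 0 < P2) (hPR : 0 < PR)
  (hbeta0 : 0 < beta) (hbeta1 : beta < 1)
  (K1 K2 : ℝ → ℝ)
  (hK1 : ∀ x : ℝ, K1 x =
    beta / 2 * Real.logb 2 (1 + hD ^ 2 * P1 + hR ^ 2 * P1 / (1 + x)) +
      (1 - beta) / 2 * Real.logb 2 (1 + hD ^ 2 * P2))
  (hK2 : ∀ x : ℝ, K2 x =
    beta / 2 * Real.logb 2 ((1 + hD ^ 2 * P1) * x / (1 + x)) +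
      (1 - beta) / 2 * Real.logb 2 (1 + hD ^ 2 * P2 + hRD ^ 2 * PR))
  (hR0 : hR ≠ 0) (hRD0 : hRD ≠ 0)
  (sig : ℝ)
  (hsig : sig = (1 + hR ^ 2 * P1 / (1 + hD ^ 2 * P1)) /
      ((1 + hRD ^ 2 * PR / (1 + hD ^ 2 * P2)) ^ ((1 - beta) / beta) - 1))
  : ∀ x : ℝ, 0 < x → K1 x = K2 x → x = sig := by
  intro x hx hK
  have hA : 0 < 1 + hD ^ 2 * P1 := by positivity
  have hB : 0 < 1 + hD ^ 2 * P2 := by positivity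
  have hc : 0 < hR ^ 2 * P1 := by positivity
  have hd : 0 < hRD ^ 2 * PR := by positivity
  rw [hK1, hK2] at hK
  generalize 1 + hD ^ 2 * P1 = A at *
  generalize 1 + hD ^ 2 * P2 = B at *
  generalize hR ^ 2 * P1 = c at *
  generalize hRD ^ 2 * PR = d at *
  have hlog := mul_logb_eq_logb_rpow_mul hbeta0.ne' (by positivity : A * x / (1 + x) ≠ 0) hB (by positivity : 0 < B + d) hK
  rw [show (B + d) / B = 1 + d / B by field_simp] at hlog
  have hq : 1 < (1 + d / B) ^ ((1 - beta) / beta) :=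
    Real.one_lt_rpow (by linarith [div_pos hd hB]) (div_pos (by linarith) hbeta0)
  generalize (1 + d / B) ^ ((1 - beta) / beta) = q at *
  have hq0 : 0 < q := one_pos.trans hq
  have hsolve : A + c / (1 + x) = A * x / (1 + x) * q :=
    Real.logb_injOn_pos one_lt_two (Set.mem_Ioi.2 (by positivity))
      (Set.mem_Ioi.2 (by positivity)) hlog
  rw [hsig, eq_div_iff (sub_pos.2 hq).ne']
  field_simp at hsolve ⊢
  linarith
end

section
/- Suppose hRD ≠ 0, and let σᵢ*² := (1 + hR²·P1/(1 + hD²·P1)) / ((1 + hRD²·PR/(1 + hD²·P2))^((1−β)/β) − 1). Then σᵢ*² maximizes the GQF achievable individual rate over all quantization-noise variances: for every x > 0, min(K1(x), K2(x)) ≤ min(K1(σᵢ*²), K2(σᵢ*²)), and the maximal value equals K1(σᵢ*²). -/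
theorem stmt_14
  (hD hR hRD P1 P2 PR beta : ℝ)
  (hP1 : 0 < P1) (hP2 : 0 < P2) (hPR : 0 < PR)
  (hbeta0 : 0 < beta) (hbeta1 : beta < 1)
  (K1 K2 : ℝ → ℝ)
  (hK1 : ∀ x : ℝ, K1 x =
    beta / 2 * Real.logb 2 (1 + hD ^ 2 * P1 + hR ^ 2 * P1 / (1 + x)) +
      (1 - beta) / 2 * Real.logb 2 (1 + hD ^ 2 * P2))
  (hK2 : ∀ x : ℝ, K2 x =
    beta / 2 * Real.logb 2 ((1 + hD ^ 2 * P1) * x / (1 + x)) +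
      (1 - beta) / 2 * Real.logb 2 (1 + hD ^ 2 * P2 + hRD ^ 2 * PR))
  (hRD0 : hRD ≠ 0)
  (sig : ℝ)
  (hsig : sig = (1 + hR ^ 2 * P1 / (1 + hD ^ 2 * P1)) /
      ((1 + hRD ^ 2 * PR / (1 + hD ^ 2 * P2)) ^ ((1 - beta) / beta) - 1))
  : (∀ x : ℝ, 0 < x → min (K1 x) (K2 x) ≤ min (K1 sig) (K2 sig)) ∧
    min (K1 sig) (K2 sig) = K1 sig := by
  have hA : 0 < 1 + hD ^ 2 * P1 := by positivity
  have hB : 0 ≤ hR ^ 2 * P1 := by positivity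
  have hC : 0 < 1 + hD ^ 2 * P2 := by positivity
  have hD' : 0 < hRD ^ 2 * PR := by positivity
  generalize 1 + hD ^ 2 * P1 = A at *
  generalize hR ^ 2 * P1 = B at *
  generalize 1 + hD ^ 2 * P2 = C at *
  generalize hRD ^ 2 * PR = D at *
  have hbase : 1 < 1 + D / C := lt_add_of_pos_right 1 (div_pos hD' hC)
  have hT : 1 < (1 + D / C) ^ ((1 - beta) / beta) :=
    Real.one_lt_rpow hbase (div_pos (sub_pos.2 hbeta1) hbeta0)
  have hlogT : Real.logb 2 ((1 + D / C) ^ ((1 - beta) / beta)) =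
      (1 - beta) / beta * (Real.logb 2 (C + D) - Real.logb 2 C) := by
    rw [Real.logb_rpow_eq_mul_logb_of_pos (by linarith),
      ← Real.logb_div (by positivity) hC.ne', add_div, div_self hC.ne']
  generalize (1 + D / C) ^ ((1 - beta) / beta) = T at *
  have hT' : 0 < T - 1 := sub_pos.2 hT
  have hs : 0 < sig := by rw [hsig]; positivity
  have hbalance : A + B / (1 + sig) = A * sig / (1 + sig) * T := by
    have h : A * sig * (T - 1) = A + B := by rw [hsig]; field_simp
    field_simp
    linarith
  have heq : K1 sig = K2 sig := by
    rw [hK1, hK2, hbalance, Real.logb_mul (by positivity) (by positivity), hlogT]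
    field_simp
    ring
  refine ⟨fun x hx => ?_, by rw [heq, min_self]⟩
  rw [← heq, min_self]
  rcases le_total sig x with h | h
  · refine (min_le_left _ _).trans ?_
    rw [hK1, hK1]
    gcongr
    norm_num
  · refine (min_le_right _ _).trans ?_
    rw [heq, hK2, hK2]
    have hmono : A * x / (1 + x) ≤ A * sig / (1 + sig) := by
      rw [div_le_div_iff₀ (by positivity) (by positivity)]
      nlinarith [mul_le_mul_of_nonneg_left h hA.le]
    gcongr
    norm_num
end

section
/- Suppose hRD ≠ 0, let σᵢ*² := (1 + hR²·P1/(1 + hD²·P1)) / ((1 + hRD²·PR/(1 + hD²·P2))^((1−β)/β) − 1), and let x ≥ σᵢ*². Then K1(x) ≤ K2(x); in particular the GQF achievable individual rate min(K1(x), K2(x)) equals the compress-and-forward individual rate K1(x). -/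
theorem stmt_15
  (hD hR hRD P1 P2 PR beta : ℝ)
  (hP1 : 0 < P1) (hP2 : 0 < P2) (hPR : 0 < PR)
  (hbeta0 : 0 < beta) (hbeta1 : beta < 1)
  (K1 K2 : ℝ → ℝ)
  (hK1 : ∀ x : ℝ, K1 x =
    beta / 2 * Real.logb 2 (1 + hD ^ 2 * P1 + hR ^ 2 * P1 / (1 + x)) +
      (1 - beta) / 2 * Real.logb 2 (1 + hD ^ 2 * P2))
  (hK2 : ∀ x : ℝ, K2 x =
    beta / 2 * Real.logb 2 ((1 + hD ^ 2 * P1) * x / (1 + x)) +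
      (1 - beta) / 2 * Real.logb 2 (1 + hD ^ 2 * P2 + hRD ^ 2 * PR))
  (hRD0 : hRD ≠ 0)
  (sig : ℝ)
  (hsig : sig = (1 + hR ^ 2 * P1 / (1 + hD ^ 2 * P1)) /
      ((1 + hRD ^ 2 * PR / (1 + hD ^ 2 * P2)) ^ ((1 - beta) / beta) - 1))
  (x : ℝ) (hx : sig ≤ x)
  : K1 x ≤ K2 x ∧ min (K1 x) (K2 x) = K1 x := by
  have hA : 0 < 1 + hD ^ 2 * P1 := by positivity
  have hB : 0 < 1 + hD ^ 2 * P2 := by positivity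
  have hG : 0 ≤ hR ^ 2 * P1 := by positivity
  have hQ : 0 < hRD ^ 2 * PR := by positivity
  suffices h : K1 x ≤ K2 x from ⟨h, min_eq_left h⟩
  rw [hK1, hK2]
  generalize 1 + hD ^ 2 * P1 = A at *
  generalize 1 + hD ^ 2 * P2 = B at *
  generalize hR ^ 2 * P1 = G at *
  generalize hRD ^ 2 * PR = Q at *
  have hs : 1 < 1 + Q / B := lt_add_of_pos_right 1 (div_pos hQ hB)
  have hlogB : Real.logb 2 (B + Q) = Real.logb 2 B + Real.logb 2 (1 + Q / B) := by
    rw [← Real.logb_mul hB.ne' (by positivity)]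
    congr 1
    field_simp
  rw [hlogB]
  generalize 1 + Q / B = s at *
  have ht : 1 < s ^ ((1 - beta) / beta) :=
    Real.one_lt_rpow hs (div_pos (sub_pos.2 hbeta1) hbeta0)
  have hlogt : beta * Real.logb 2 (s ^ ((1 - beta) / beta)) = (1 - beta) * Real.logb 2 s := by
    rw [Real.logb_rpow_eq_mul_logb_of_pos (by positivity)]
    field_simp
  generalize s ^ ((1 - beta) / beta) = t at *
  have hx0 : 0 < x := by
    refine lt_of_lt_of_le ?_ hx
    rw [hsig]
    exact div_pos (by positivity) (sub_pos.2 ht)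
  have hkey : A + G ≤ A * (x * (t - 1)) := by
    rw [hsig, div_le_iff₀ (sub_pos.2 ht)] at hx
    calc A + G = A * (1 + G / A) := by field_simp
      _ ≤ A * (x * (t - 1)) := mul_le_mul_of_nonneg_left hx hA.le
  have harg : A + G / (1 + x) ≤ A * x / (1 + x) * t := by
    rw [div_mul_eq_mul_div, le_div_iff₀ (by positivity), add_mul,
      div_mul_cancel₀ _ (by positivity)]
    linarith
  have hlog : Real.logb 2 (A + G / (1 + x)) ≤
      Real.logb 2 (A * x / (1 + x)) + Real.logb 2 t := by
    rw [← Real.logb_mul (by positivity) (by positivity)]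
    exact Real.logb_le_logb_of_le one_lt_two (by positivity) harg
  linarith [mul_le_mul_of_nonneg_left hlog hbeta0.le]
end
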